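/- The fraction 4055/4093 is equal to the sum of the six distinct unit fractions 1/2 + 1/3 + 1/7 + 1/69 + 1/30650 + 1/10098761225; moreover, this is the unique representation of 4055/4093 as a sum of six distinct positive unit fractions (i.e., any finite set of six distinct positive integers whose reciprocals sum to 4055/4093 must be {2, 3, 7, 69, 30650, 10098761225}), and no representation of 4055/4093 as a sum of fewer than six distinct positive unit fractions exists. -/

import Mathlib

/-- `force n f = f n`, but the kernel evaluates `n` to a literal first. -/
def force (n : ℕ) (f : ℕ → Bool) : Bool :=
  Nat.rec (motive := fun _ => Bool) (f 0) (fun m _ => f (Nat.succ m)) n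

theorem force_eq (n : ℕ) (f : ℕ → Bool) : force n f = f n := by
  cases n <;> rfl

/-- `allRange p d lo hi` tests `p` on all `n` with `lo ≤ n < min hi (lo + 2 ^ d)`. -/
def allRange (p : ℕ → Bool) (d : ℕ) : ℕ → ℕ → Bool :=
  Nat.rec (motive := fun _ => ℕ → ℕ → Bool)
    (fun lo hi => cond (Nat.ble hi lo) true (p lo))
    (fun d ih lo hi => cond (Nat.ble hi lo) true
      (cond (ih lo hi) (force (Nat.add lo (Nat.pow 2 d)) (fun m => ih m hi)) false)) d

theorem allRange_zero (p : ℕ → Bool) (lo hi : ℕ) :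
    allRange p 0 lo hi = (Nat.ble hi lo || p lo) := by
  have h : allRange p 0 lo hi = cond (Nat.ble hi lo) true (p lo) := rfl
  rw [h, Bool.cond_true_left]

theorem allRange_succ (p : ℕ → Bool) (d lo hi : ℕ) : allRange p (d + 1) lo hi =
    (Nat.ble hi lo || (allRange p d lo hi && allRange p d (lo + 2 ^ d) hi)) := by
  have h : allRange p (d + 1) lo hi = cond (Nat.ble hi lo) true (cond (allRange p d lo hi)
      (force (lo + 2 ^ d) (fun m => allRange p d m hi)) false) := rfl
  rw [h, force_eq, Bool.cond_true_left, Bool.cond_false_right]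

theorem allRange_spec (p : ℕ → Bool) : ∀ d lo hi : ℕ, allRange p d lo hi = true →
    ∀ n, lo ≤ n → n < hi → n < lo + 2 ^ d → p n = true := by
  intro d
  induction d with
  | zero =>
    intro lo hi h n h1 h2 h3
    have hn : n = lo := by simp at h3; omega
    subst hn
    simp only [allRange_zero, Bool.or_eq_true, Nat.ble_eq] at h
    rcases h with h | h
    · omega
    · exact h
  | succ d ih =>
    intro lo hi h n h1 h2 h3
    simp only [allRange_succ, Bool.or_eq_true, Bool.and_eq_true, Nat.ble_eq] at h
    rcases h with h | ⟨ha, hb⟩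
    · omega
    · by_cases hc : n < lo + 2 ^ d
      · exact ih lo hi ha n h1 h2 hc
      · exact ih _ hi hb n (by omega) h2 (by rw [pow_succ] at h3; omega)

/-- The search for the last unit fraction: is `N / D` the reciprocal of an integer `> last`? -/
def searchOne (N D last : ℕ) (ok : List ℕ → Bool) : Bool :=
  cond (Nat.beq (Nat.mod D N) 0) (Nat.ble (D / N) last || ok [D / N]) true

/-- Exhaustive search: every increasing list of `k + 1` integers `> last` whose reciprocals sum
to `N / D` satisfies `ok`. -/
def search (k : ℕ) : ℕ → ℕ → ℕ → (List ℕ → Bool) → Bool :=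
  Nat.rec (motive := fun _ => ℕ → ℕ → ℕ → (List ℕ → Bool) → Bool) searchOne
    (fun k ih N₀ D₀ last₀ ok =>
      force N₀ fun N => force D₀ fun D => force last₀ fun last =>
      force (max (D / N) last + 1) fun lo => force ((k + 2) * D / N + 1) fun hi =>
      Nat.ble hi (2 ^ 16) &&
        allRange (fun n => ih (Nat.sub (Nat.mul N n) D) (Nat.mul D n) n
          (fun l => ok (n :: l))) 16 lo hi) k

theorem search_succ (k N D last : ℕ) (ok : List ℕ → Bool) : search (k + 1) N D last ok =
    (Nat.ble ((k + 2) * D / N + 1) (2 ^ 16) &&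
      allRange (fun n => search k (N * n - D) (D * n) n (fun l => ok (n :: l))) 16
        (max (D / N) last + 1) ((k + 2) * D / N + 1)) := by
  have h : search (k + 1) N D last ok = (force N fun N => force D fun D => force last fun last =>
      force (max (D / N) last + 1) fun lo => force ((k + 2) * D / N + 1) fun hi =>
      Nat.ble hi (2 ^ 16) &&
        allRange (fun n => search k (N * n - D) (D * n) n (fun l => ok (n :: l))) 16 lo hi) := rfl
  rw [h]
  simp only [force_eq]

theorem sum_le_aux (n : ℕ) (hn : 0 < n) : ∀ l : List ℕ, (∀ x ∈ l, n < x) →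
    (l.map (fun m : ℕ => (1 : ℚ) / m)).sum ≤ l.length / n := by
  intro l
  induction l with
  | nil => simp
  | cons a t ih =>
    intro h
    have h1 := ih (fun x hx => h x (List.mem_cons_of_mem _ hx))
    have h2 : n < a := h a List.mem_cons_self
    have h3 : (1 : ℚ) / a ≤ 1 / n := by
      apply one_div_le_one_div_of_le
      · exact_mod_cast hn
      · exact_mod_cast h2.le
    simp only [List.map_cons, List.sum_cons, List.length_cons]
    push_cast
    rw [add_div]
    linarith

theorem sum_pos_aux : ∀ l : List ℕ, l ≠ [] → (∀ x ∈ l, 0 < x) →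
    0 < (l.map (fun m : ℕ => (1 : ℚ) / m)).sum := by
  intro l hl h
  apply List.sum_pos
  · intro x hx
    obtain ⟨m, hm, rfl⟩ := List.mem_map.1 hx
    have := h m hm
    positivity
  · simpa using hl

theorem search_spec : ∀ (k N D last : ℕ) (ok : List ℕ → Bool), 0 < D →
    search k N D last ok = true → ∀ l : List ℕ, l.length = k + 1 → l.Pairwise (· < ·) →
    (∀ x ∈ l, last < x) → (l.map (fun m : ℕ => (1 : ℚ) / m)).sum * D = N → ok l = true := by
  intro k
  induction k using Nat.strong_induction_on with
  | _ k ih =>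
    intro N D last ok hD h l hl hp hlast hs
    obtain ⟨n, t, rfl⟩ : ∃ n t, l = n :: t := by
      cases l with
      | nil => simp at hl
      | cons n t => exact ⟨n, t, rfl⟩
    have hn : last < n := hlast n List.mem_cons_self
    have hn0 : 0 < n := by omega
    have hnq : (0 : ℚ) < n := by exact_mod_cast hn0
    have hDq : (0 : ℚ) < D := by exact_mod_cast hD
    have htl : t.length = k := by simpa using hl
    rw [List.pairwise_cons] at hp
    obtain ⟨hnt, htp⟩ := hp
    simp only [List.map_cons, List.sum_cons] at hs
    set s := (t.map (fun m : ℕ => (1 : ℚ) / m)).sum with hsdef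
    have hs0 : 0 ≤ s := by
      apply List.sum_nonneg
      intro x hx
      obtain ⟨m, hm, rfl⟩ := List.mem_map.1 hx
      positivity
    have hN : 0 < N := by
      have : (0 : ℚ) < N := by rw [← hs]; positivity
      exact_mod_cast this
    -- the equation, cleared of the first denominator
    have heq : s * (D * n) = N * n - D := by
      rw [← hs]; field_simp; ring
    cases k with
    | zero =>
      obtain rfl := List.length_eq_zero_iff.1 htl
      have hs1 : s = 0 := by simp [hsdef]
      rw [hs1] at heq
      have hDN : D = N * n := by
        have : (D : ℚ) = N * n := by linarith
        exact_mod_cast this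
      have hdiv : D / N = n := by rw [hDN]; exact Nat.mul_div_cancel_left n hN
      have hmod : D % N = 0 := by rw [hDN]; exact Nat.mul_mod_right N n
      have h' : searchOne N D last ok = true := h
      have hmod' : Nat.mod D N = 0 := hmod
      simp only [searchOne, hdiv, hmod', Nat.beq_refl, cond_true, Bool.or_eq_true,
        Nat.ble_eq] at h'
      rcases h' with h' | h'
      · omega
      · exact h'
    | succ k =>
      have hspos : 0 < s := by
        apply sum_pos_aux
        · rintro rfl; simp at htl
        · intro x hx; have := hnt x hx; omega
      have hlt : D < N * n := by
        have : (0 : ℚ) < N * n - D := by rw [← heq]; positivity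
        have : (D : ℚ) < N * n := by linarith
        exact_mod_cast this
      have hle : n * N ≤ (k + 2) * D := by
        have h1 := sum_le_aux n hn0 t hnt
        rw [← hsdef, htl] at h1
        have h2 : s * n ≤ (k + 1 : ℕ) := by rwa [le_div_iff₀ hnq] at h1
        have h3 : s * n * D ≤ (k + 1 : ℕ) * D := mul_le_mul_of_nonneg_right h2 hDq.le
        have h4 : (n : ℚ) * N ≤ (k + 2) * D := by push_cast at h3; nlinarith
        exact_mod_cast h4
      have hlo : D / N + 1 ≤ n := by
        rw [Nat.succ_le_iff, Nat.div_lt_iff_lt_mul hN]; rwa [mul_comm] at hlt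
      have hhi : n ≤ (k + 2) * D / N := (Nat.le_div_iff_mul_le hN).2 hle
      rw [search_succ, Bool.and_eq_true, Nat.ble_eq] at h
      obtain ⟨hb, h⟩ := h
      have h5 := allRange_spec _ _ _ _ h n (by omega) (by omega) (by omega)
      refine ih k (Nat.lt_succ_self k) _ _ _ _ (Nat.mul_pos hD hn0) h5 t htl htp hnt ?_
      rw [← hsdef, Nat.cast_sub hlt.le]
      push_cast
      exact heq

theorem search_six : search 5 4055 4093 0
    (fun l => decide (l = [2, 3, 7, 69, 30650, 10098761225])) = true := by
  decide +kernel

theorem search_small : ∀ k < 5, search k 4055 4093 0 (fun _ => false) = true := by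
  decide +kernel

theorem search_finset (S : Finset ℕ) (hS : ∀ n ∈ S, 0 < n)
    (hs : (∑ n ∈ S, (1 : ℚ) / n) = 4055 / 4093) (k : ℕ) (hk : S.card = k + 1)
    (ok : List ℕ → Bool) (h : search k 4055 4093 0 ok = true) :
    ok (S.sort (· ≤ ·)) = true := by
  refine search_spec _ _ _ _ _ (by norm_num) h _ (by simp [hk])
    (Finset.sortedLT_sort S).pairwise (fun x hx => hS x (by simpa using hx)) ?_
  have : ((S.sort (· ≤ ·)).map (fun m : ℕ => (1 : ℚ) / m)).sum = ∑ n ∈ S, (1 : ℚ) / n := by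
    conv_rhs => rw [← Finset.sort_toFinset S (· ≤ ·)]
    rw [List.sum_toFinset _ (Finset.sort_nodup S (· ≤ ·))]
  rw [this, hs]
  norm_num

/-- The fraction 4055/4093 equals the sum of the six distinct unit fractions
1/2 + 1/3 + 1/7 + 1/69 + 1/30650 + 1/10098761225; this six-term Egyptian
fraction decomposition is unique, and no decomposition into fewer than six
distinct positive unit fractions exists. -/
theorem egyptian_fraction_4055_4093 :
    ((1 : ℚ)/2 + 1/3 + 1/7 + 1/69 + 1/30650 + 1/10098761225 = 4055/4093) ∧
    (∀ S : Finset ℕ, (∀ n ∈ S, 0 < n) → S.card = 6 →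
      (∑ n ∈ S, (1 : ℚ)/n) = 4055/4093 →
      S = ({2, 3, 7, 69, 30650, 10098761225} : Finset ℕ)) ∧
    (∀ S : Finset ℕ, (∀ n ∈ S, 0 < n) → S.card < 6 →
      (∑ n ∈ S, (1 : ℚ)/n) ≠ 4055/4093) := by
  refine ⟨by norm_num, ?_, ?_⟩
  · intro S hS hc hs
    have h := search_finset S hS hs 5 hc _ search_six
    have h' := of_decide_eq_true h
    rw [← Finset.sort_toFinset S (· ≤ ·), h']
    rfl
  · intro S hS hc hs
    rcases Nat.eq_zero_or_eq_succ_pred S.card with h0 | h0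
    · rw [Finset.card_eq_zero] at h0
      subst h0
      norm_num at hs
    · have h := search_finset S hS hs _ h0 _ (search_small S.card.pred (by omega))
      simp at h
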